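/- The Rule of Necessitation is admissible in 𝔊: for every formula φ, if the sequent ⇒ φ is provable in 𝔊 then the sequent ⇒ □φ is provable in 𝔊. -/

import Mathlib

/-- Formulas built from propositional variables and the constant `⊥`
by the connectives `∧`, `∨`, `¬`, `□`. -/
inductive FormulaB : Type where
  | var : ℕ → FormulaB
  | bot : FormulaB
  | and : FormulaB → FormulaB → FormulaB
  | or : FormulaB → FormulaB → FormulaB
  | neg : FormulaB → FormulaB
  | box : FormulaB → FormulaB
deriving DecidableEq
/-- The Font–Rius sequent calculus 𝔊.  `Gder c Δ α` means the sequent `Δ ⇒ α` has a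
derivation; when `c = false` the cut rule is not allowed (cut-free derivability),
`Gder true` is plain derivability. -/
inductive Gder : Bool → Finset FormulaB → FormulaB → Prop where
  | ax (c : Bool) (α : FormulaB) : Gder c {α} α
  | modal (c : Bool) (α : FormulaB) : Gder c ∅ (α.or α.box.neg)
  | weak {c Δ α} (β : FormulaB) : Gder c Δ α → Gder c (insert β Δ) α
  | cut {Δ : Finset FormulaB} {α β : FormulaB} :
      Gder true Δ α → Gder true (insert α Δ) β → Gder true Δ β
  | andL {c Δ γ} (α β : FormulaB) :
      Gder c (insert α (insert β Δ)) γ → Gder c (insert (α.and β) Δ) γ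
  | andR {c Δ} {α β : FormulaB} : Gder c Δ α → Gder c Δ β → Gder c Δ (α.and β)
  | orL {c Δ γ} (α β : FormulaB) :
      Gder c (insert α Δ) γ → Gder c (insert β Δ) γ → Gder c (insert (α.or β) Δ) γ
  | orR1 {c Δ} {α : FormulaB} (β : FormulaB) : Gder c Δ α → Gder c Δ (α.or β)
  | orR2 {c Δ} (α : FormulaB) {β : FormulaB} : Gder c Δ β → Gder c Δ (α.or β)
  | negRule {c} {α β : FormulaB} : Gder c {α} β → Gder c {β.neg} α.neg
  | botRule {c Δ} (α : FormulaB) : Gder c Δ FormulaB.bot → Gder c Δ α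
  | nnL {c Δ β} (α : FormulaB) : Gder c (insert α Δ) β → Gder c (insert α.neg.neg Δ) β
  | nnR {c Δ} {α : FormulaB} : Gder c Δ α → Gder c Δ α.neg.neg
  | boxL {c Δ β} (α : FormulaB) :
      Gder c (insert α (insert α.neg Δ)) β → Gder c (insert α (insert α.box.neg Δ)) β
  | boxR {c Δ} {α : FormulaB} :
      Gder c Δ (α.and α.neg) → Gder c Δ (α.and α.box.neg)

namespace Gder

/-- Cut of a theorem against a sequent with a single antecedent. -/
theorem cut_singleton {α β : FormulaB} (h₁ : Gder true ∅ α) (h₂ : Gder true {α} β) :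
    Gder true ∅ β :=
  cut h₁ (by simpa using h₂)

theorem bot_left (c : Bool) (α : FormulaB) : Gder c {FormulaB.bot} α :=
  botRule α (ax c _)

theorem of_neg_neg (c : Bool) (α : FormulaB) : Gder c {α.neg.neg} α := by
  have h : Gder c (insert α ∅) α := by simpa using ax c α
  simpa using nnL α h

theorem neg_bot : Gder true ∅ FormulaB.bot.neg := by
  refine cut_singleton (modal true FormulaB.bot) ?_
  have h₁ : Gder true (insert FormulaB.bot ∅) FormulaB.bot.neg := by
    simpa using bot_left true FormulaB.bot.neg
  have h₂ : Gder true (insert FormulaB.bot.box.neg ∅) FormulaB.bot.neg := by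
    simpa using negRule (bot_left true FormulaB.bot.box)
  simpa using orL _ _ h₁ h₂

/-- The negation of a theorem is inconsistent. -/
theorem neg_left_of_provable {φ : FormulaB} (h : Gder true ∅ φ) :
    Gder true {φ.neg} FormulaB.bot := by
  have h₁ : Gder true {FormulaB.bot.neg} φ := by simpa using weak FormulaB.bot.neg h
  refine cut (negRule h₁) ?_
  have h₂ := weak φ.neg (of_neg_neg true FormulaB.bot)
  rwa [Finset.pair_comm] at h₂

/-- If the negation of a formula is inconsistent, the formula is a theorem. -/
theorem of_neg_left {α : FormulaB} (h : Gder true {α.neg} FormulaB.bot) : Gder true ∅ α :=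
  cut_singleton (cut_singleton neg_bot (negRule h)) (of_neg_neg true α)

end Gder

/-- The Rule of Necessitation is admissible in 𝔊. -/
theorem necessitation_admissible (φ : FormulaB) :
    Gder true ∅ φ → Gder true ∅ φ.box := by
  intro h
  refine Gder.of_neg_left ?_
  have h₁ : Gder true (insert φ (insert φ.neg ∅)) FormulaB.bot := by
    simpa using Gder.weak φ (Gder.neg_left_of_provable h)
  have h₂ : Gder true (insert φ {φ.box.neg}) FormulaB.bot := by
    simpa using Gder.boxL φ h₁
  have h₃ : Gder true {φ.box.neg} φ := by simpa using Gder.weak φ.box.neg h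
  exact Gder.cut h₃ h₂
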